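/- arXiv:1012.0402 — 2 statements merged into one kernel-verified Lean document; each statement's English description precedes it below -/
import Mathlib

section
/- Let g be a finite-dimensional real Lie algebra and let c be an alternating 3-form on g that is closed (dc = 0 for the Chevalley–Eilenberg differential) and g-invariant, i.e. c([x,y_1],y_2,y_3) + c(y_1,[x,y_2],y_3) + c(y_1,y_2,[x,y_3]) = 0 for all x, y_1, y_2, y_3 in g. If x_1,…,x_m, y_1,…,y_m in g satisfy Σ_i [x_i,y_i] = 0 (so that p = Σ_i x_i ∧ y_i lies in the Lie kernel, the kernel of the bracket-induced map Λ²g → g), then the 1-form α(z) = Σ_i c(x_i,y_i,z) is closed; that is, Σ_i c(x_i,y_i,[z,w]) = 0 for all z, w in g. -/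
/-!  Chevalley–Eilenberg calculus in low degrees for a real Lie algebra. -/

namespace CE

variable {L : Type*} [LieRing L] [LieAlgebra ℝ L]

/-- A 1-form `α` is closed when `dα = 0`, i.e. `α` vanishes on all brackets
(recall `dα(x,y) = -α ⁅x,y⁆`). -/
def IsClosed1 (α : L →ₗ[ℝ] ℝ) : Prop := ∀ x y : L, α ⁅x, y⁆ = 0

/-- A 2-form `ω` is closed when `dω = 0`, where
`dω(x,y,z) = -ω(⁅x,y⁆,z) + ω(⁅x,z⁆,y) - ω(⁅y,z⁆,x)`. -/
def IsClosed2 (ω : L [⋀^Fin 2]→ₗ[ℝ] ℝ) : Prop :=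
  ∀ x y z : L, -ω ![⁅x, y⁆, z] + ω ![⁅x, z⁆, y] - ω ![⁅y, z⁆, x] = 0

/-- A 2-form `ω` is exact when `ω = dα` for some 1-form `α`. -/
def IsExact2 (ω : L [⋀^Fin 2]→ₗ[ℝ] ℝ) : Prop :=
  ∃ α : L →ₗ[ℝ] ℝ, ∀ x y : L, ω ![x, y] = -α ⁅x, y⁆

/-- A 3-form `c` is closed when `dc = 0`, where
`dc(x,y,z,w) = -c(⁅x,y⁆,z,w) + c(⁅x,z⁆,y,w) - c(⁅x,w⁆,y,z)
             - c(⁅y,z⁆,x,w) + c(⁅y,w⁆,x,z) - c(⁅z,w⁆,x,y)`. -/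
def IsClosed3 (c : L [⋀^Fin 3]→ₗ[ℝ] ℝ) : Prop :=
  ∀ x y z w : L,
    -c ![⁅x, y⁆, z, w] + c ![⁅x, z⁆, y, w] - c ![⁅x, w⁆, y, z]
      - c ![⁅y, z⁆, x, w] + c ![⁅y, w⁆, x, z] - c ![⁅z, w⁆, x, y] = 0

/-- A 3-form `c` is exact when `c = dω` for some 2-form `ω`. -/
def IsExact3 (c : L [⋀^Fin 3]→ₗ[ℝ] ℝ) : Prop :=
  ∃ ω : L [⋀^Fin 2]→ₗ[ℝ] ℝ, ∀ x y z : L,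
    c ![x, y, z] = -ω ![⁅x, y⁆, z] + ω ![⁅x, z⁆, y] - ω ![⁅y, z⁆, x]

/-- A Lie algebra is `(2,3)`-trivial when `b₂ = 0 = b₃`, i.e. every closed
2-form and every closed 3-form is exact. -/
def Is23Trivial (M : Type*) [LieRing M] [LieAlgebra ℝ M] : Prop :=
  (∀ ω : M [⋀^Fin 2]→ₗ[ℝ] ℝ, IsClosed2 ω → IsExact2 ω) ∧
  (∀ c : M [⋀^Fin 3]→ₗ[ℝ] ℝ, IsClosed3 c → IsExact3 c)

end CE

namespace CE

theorem update_head {α : Type*} (a b d e : α) :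
    Function.update ![a, b, d] 0 e = ![e, b, d] := by
  funext i
  fin_cases i <;> rfl

variable {L : Type*} [LieRing L] [LieAlgebra ℝ L]

theorem map_swap_left (c : L [⋀^Fin 3]→ₗ[ℝ] ℝ) (a b d : L) :
    c ![b, a, d] = -c ![a, b, d] := by
  rw [← c.map_swap ![a, b, d] (show (0 : Fin 3) ≠ 1 by decide)]
  congr 1
  ext i
  fin_cases i <;> rfl

theorem map_swap_right (c : L [⋀^Fin 3]→ₗ[ℝ] ℝ) (a b d : L) :
    c ![a, d, b] = -c ![a, b, d] := by
  rw [← c.map_swap ![a, b, d] (show (1 : Fin 3) ≠ 2 by decide)]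
  congr 1
  ext i
  fin_cases i <;> rfl

/-- For a closed invariant 3-form, `c(x, y, ⁅z, w⁆) = c(⁅x, y⁆, z, w)`. -/
theorem IsClosed3.map_lie_right {c : L [⋀^Fin 3]→ₗ[ℝ] ℝ} (hclosed : IsClosed3 c)
    (hinv : ∀ x y₁ y₂ y₃ : L,
      c ![⁅x, y₁⁆, y₂, y₃] + c ![y₁, ⁅x, y₂⁆, y₃] + c ![y₁, y₂, ⁅x, y₃⁆] = 0)
    (x y z w : L) : c ![x, y, ⁅z, w⁆] = c ![⁅x, y⁆, z, w] := by
  have rotate (a b d : L) : c ![a, b, d] = c ![d, a, b] := by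
    rw [map_swap_right c a d b, map_swap_left c d a b, neg_neg]
  have lie_swap : c ![⁅y, x⁆, z, w] = -c ![⁅x, y⁆, z, w] := by
    rw [← lie_skew]
    simpa [update_head, -lie_skew] using c.map_update_neg ![⁅x, y⁆, z, w] 0 ⁅x, y⁆
  have hx := hinv x y z w
  have hy := hinv y x z w
  have hc := hclosed x y z w
  rw [map_swap_left c ⁅x, z⁆ y w, rotate y z ⁅x, w⁆] at hx
  rw [lie_swap, map_swap_left c ⁅y, z⁆ x w, rotate x z ⁅y, w⁆] at hy
  rw [rotate x y ⁅z, w⁆]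
  linarith

end CE

/-- for a closed invariant 3-form `c` and an element
`p = Σ xᵢ ∧ yᵢ` of the Lie kernel (i.e. `Σ ⁅xᵢ, yᵢ⁆ = 0`), the 1-form
`z ↦ Σ c(xᵢ, yᵢ, z)` is closed, i.e. vanishes on all brackets. -/
theorem stmt_2 (g : Type) [LieRing g] [LieAlgebra ℝ g] [FiniteDimensional ℝ g]
    (c : g [⋀^Fin 3]→ₗ[ℝ] ℝ) (hclosed : CE.IsClosed3 c)
    (hinv : ∀ x y₁ y₂ y₃ : g,
      c ![⁅x, y₁⁆, y₂, y₃] + c ![y₁, ⁅x, y₂⁆, y₃] + c ![y₁, y₂, ⁅x, y₃⁆] = 0)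
    (m : ℕ) (x y : Fin m → g) (hp : ∑ i, ⁅x i, y i⁆ = 0) :
    ∀ z w : g, ∑ i, c ![x i, y i, ⁅z, w⁆] = 0 := by
  intro z w
  simp_rw [hclosed.map_lie_right hinv]
  let f : g →ₗ[ℝ] ℝ := c.toMultilinearMap.toLinearMap ![0, z, w] 0
  have hf (a : g) : f a = c ![a, z, w] := by simp [f, CE.update_head]
  simp_rw [← hf]
  rw [← map_sum, hp, map_zero]
end

section
/- Every (2,3)-trivial real Lie algebra of dimension two, three or four is not unimodular; that is, there exists an element x of the algebra with tr(ad_x) ≠ 0. -/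
namespace CE

variable {g : Type*} [LieRing g] [LieAlgebra ℝ g]

section slots
variable {V : Type*} [AddCommGroup V] [Module ℝ V]

lemma form2_add_left (ω : V [⋀^Fin 2]→ₗ[ℝ] ℝ) (x x' y : V) :
    ω ![x + x', y] = ω ![x, y] + ω ![x', y] :=
  ω.map_vecCons_add ![y] x x'

lemma form2_smul_left (ω : V [⋀^Fin 2]→ₗ[ℝ] ℝ) (r : ℝ) (x y : V) :
    ω ![r • x, y] = r * ω ![x, y] :=
  ω.map_vecCons_smul ![y] r x

lemma form2_self (ω : V [⋀^Fin 2]→ₗ[ℝ] ℝ) (x : V) : ω ![x, x] = 0 :=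
  ω.map_eq_zero_of_eq ![x, x] (i := 0) (j := 1) rfl (by decide)

lemma form2_swap (ω : V [⋀^Fin 2]→ₗ[ℝ] ℝ) (x y : V) : ω ![x, y] = -ω ![y, x] := by
  have h := ω.map_swap ![y, x] (i := 0) (j := 1) (by decide)
  rw [← h]; congr 1; ext i; fin_cases i <;> rfl

lemma form3_add (c : V [⋀^Fin 3]→ₗ[ℝ] ℝ) (x x' y z : V) :
    c ![x + x', y, z] = c ![x, y, z] + c ![x', y, z] :=
  c.map_vecCons_add ![y, z] x x'

lemma form3_smul (c : V [⋀^Fin 3]→ₗ[ℝ] ℝ) (r : ℝ) (x y z : V) :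
    c ![r • x, y, z] = r * c ![x, y, z] :=
  c.map_vecCons_smul ![y, z] r x

lemma form3_swap01 (c : V [⋀^Fin 3]→ₗ[ℝ] ℝ) (x y z : V) :
    c ![x, y, z] = -c ![y, x, z] := by
  have h := c.map_swap ![y, x, z] (i := 0) (j := 1) (by decide)
  rw [← h]; congr 1; ext i; fin_cases i <;> rfl

lemma form3_swap12 (c : V [⋀^Fin 3]→ₗ[ℝ] ℝ) (x y z : V) :
    c ![x, y, z] = -c ![x, z, y] := by
  have h := c.map_swap ![x, z, y] (i := 1) (j := 2) (by decide)
  rw [← h]; congr 1; ext i; fin_cases i <;> rfl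

lemma form3_self01 (c : V [⋀^Fin 3]→ₗ[ℝ] ℝ) (x z : V) : c ![x, x, z] = 0 :=
  c.map_eq_zero_of_eq ![x, x, z] (i := 0) (j := 1) rfl (by decide)

lemma form3_self12 (c : V [⋀^Fin 3]→ₗ[ℝ] ℝ) (x z : V) : c ![x, z, z] = 0 :=
  c.map_eq_zero_of_eq ![x, z, z] (i := 1) (j := 2) rfl (by decide)

lemma form3_add1 (c : V [⋀^Fin 3]→ₗ[ℝ] ℝ) (x y y' z : V) :
    c ![x, y + y', z] = c ![x, y, z] + c ![x, y', z] := by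
  rw [form3_swap01, form3_add, form3_swap01 c y, form3_swap01 c y']; ring

lemma form3_smul1 (c : V [⋀^Fin 3]→ₗ[ℝ] ℝ) (r : ℝ) (x y z : V) :
    c ![x, r • y, z] = r * c ![x, y, z] := by
  rw [form3_swap01, form3_smul, form3_swap01 c y]; ring

lemma form3_add2 (c : V [⋀^Fin 3]→ₗ[ℝ] ℝ) (x y z z' : V) :
    c ![x, y, z + z'] = c ![x, y, z] + c ![x, y, z'] := by
  rw [form3_swap12, form3_add1, form3_swap12 c x z, form3_swap12 c x z']; ring

lemma form3_smul2 (c : V [⋀^Fin 3]→ₗ[ℝ] ℝ) (r : ℝ) (x y z : V) :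
    c ![x, y, r • z] = r * c ![x, y, z] := by
  rw [form3_swap12, form3_smul1, form3_swap12 c x z]; ring

end slots

/-- The Chevalley–Eilenberg differential of a 3-form, as a 4-form. -/
def d3 (c : g [⋀^Fin 3]→ₗ[ℝ] ℝ) : g [⋀^Fin 4]→ₗ[ℝ] ℝ where
  toFun v := -c ![⁅v 0, v 1⁆, v 2, v 3] + c ![⁅v 0, v 2⁆, v 1, v 3] - c ![⁅v 0, v 3⁆, v 1, v 2]
      - c ![⁅v 1, v 2⁆, v 0, v 3] + c ![⁅v 1, v 3⁆, v 0, v 2] - c ![⁅v 2, v 3⁆, v 0, v 1]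
  map_update_add' := by
    intro inst v i x y
    obtain rfl := Subsingleton.elim inst (instDecidableEqFin 4)
    fin_cases i <;>
      simp [form3_add, form3_add1, form3_add2] <;> ring
  map_update_smul' := by
    intro inst v i x y
    obtain rfl := Subsingleton.elim inst (instDecidableEqFin 4)
    fin_cases i <;>
      simp [form3_smul, form3_smul1, form3_smul2] <;> ring
  map_eq_zero_of_eq' := by
    intro v i j h hij
    have skew (x y z w : g) : c ![⁅x, y⁆, z, w] = -c ![⁅y, x⁆, z, w] := by
      rw [← lie_skew, ← neg_one_smul ℝ, form3_smul]; ring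
    have hc : v 0 = v 1 ∨ v 0 = v 2 ∨ v 0 = v 3 ∨ v 1 = v 2 ∨ v 1 = v 3 ∨ v 2 = v 3 := by
      fin_cases i <;> fin_cases j <;> first
        | exact absurd rfl hij
        | (have h' := h.symm; tauto)
    have z0 (x y : g) : c ![0, x, y] = 0 := c.map_coord_zero (m := ![0, x, y]) 0 rfl
    rcases hc with h | h | h | h | h | h <;>
      simp only [h, lie_self, z0, form3_self12]
    · ring
    · linarith [skew (v 1) (v 2) (v 2) (v 3), form3_swap12 c ⁅v 2, v 3⁆ (v 1) (v 2)]
    · linarith [skew (v 1) (v 3) (v 2) (v 3), skew (v 2) (v 3) (v 1) (v 3),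
        form3_swap12 c ⁅v 1, v 3⁆ (v 2) (v 3), form3_swap12 c ⁅v 2, v 3⁆ (v 1) (v 3)]
    · ring
    · linarith [skew (v 2) (v 3) (v 0) (v 3), form3_swap12 c ⁅v 0, v 3⁆ (v 2) (v 3)]
    · ring

/-- The differential of a 1-form, as a 2-form. -/
def d1 : Module.Dual ℝ g →ₗ[ℝ] g [⋀^Fin 2]→ₗ[ℝ] ℝ where
  toFun α :=
    { toFun := fun v => -α ⁅v 0, v 1⁆
      map_update_add' := by
        intro inst v i x y
        obtain rfl := Subsingleton.elim inst (instDecidableEqFin 2)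
        fin_cases i <;> simp <;> ring
      map_update_smul' := by
        intro inst v i x y
        obtain rfl := Subsingleton.elim inst (instDecidableEqFin 2)
        fin_cases i <;> simp
      map_eq_zero_of_eq' := by
        intro v i j h hij
        fin_cases i <;> fin_cases j <;> simp at hij h <;> simp [h] }
  map_add' α β := by ext v; simp; ring
  map_smul' r α := by ext v; simp

lemma trace_ad {ι : Type*} [Fintype ι] [DecidableEq ι] (b : Module.Basis ι ℝ g) (x : g) :
    LinearMap.trace ℝ g (LieAlgebra.ad ℝ g x) = ∑ i, b.repr ⁅x, b i⁆ i := by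
  rw [LinearMap.trace_eq_matrix_trace ℝ b]
  simp [Matrix.trace, LinearMap.toMatrix_apply]

lemma isClosed3_iff_d3_eq_zero (c : g [⋀^Fin 3]→ₗ[ℝ] ℝ) : IsClosed3 c ↔ d3 c = 0 :=
  ⟨fun h => AlternatingMap.ext fun v => h (v 0) (v 1) (v 2) (v 3),
    fun h x y z w => congrArg (fun f => f ![x, y, z, w]) h⟩

lemma repr_lie_skew {ι : Type*} (b : Module.Basis ι ℝ g) (x y : g) (k : ι) :
    b.repr ⁅x, y⁆ k = -b.repr ⁅y, x⁆ k := by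
  rw [← lie_skew, map_neg, Finsupp.neg_apply]

/-- The exterior derivative of 2-forms evaluated at three fixed vectors. -/
def d2At (x y z : g) : (g [⋀^Fin 2]→ₗ[ℝ] ℝ) →ₗ[ℝ] ℝ where
  toFun ω := -ω ![⁅x, y⁆, z] + ω ![⁅x, z⁆, y] - ω ![⁅y, z⁆, x]
  map_add' ω η := by simp; ring
  map_smul' r ω := by simp; ring

lemma d2At_d1 (x y z : g) (α : Module.Dual ℝ g) : d2At x y z (d1 α) = 0 := by
  have h : ⁅⁅x, y⁆, z⁆ - ⁅⁅x, z⁆, y⁆ + ⁅⁅y, z⁆, x⁆ = 0 := by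
    rw [lie_lie x y z, ← lie_skew ⁅x, z⁆ y, ← lie_skew ⁅y, z⁆ x]
    abel
  have h' := congrArg α h
  simp only [map_add, map_sub, map_zero] at h'
  simp only [d2At, d1, LinearMap.coe_mk, AddHom.coe_mk, AlternatingMap.coe_mk,
    MultilinearMap.coe_mk, Matrix.cons_val_zero, Matrix.cons_val_one]
  linarith

lemma not_trivial_dim_two (b : Module.Basis (Fin 2) ℝ g)
    (hU : ∀ x : g, LinearMap.trace ℝ g (LieAlgebra.ad ℝ g x) = 0) (h23 : Is23Trivial g) :
    False := by
  have T0 := hU (b 0)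
  have T1 := hU (b 1)
  simp only [trace_ad b, Fin.sum_univ_two, lie_self, map_zero, Finsupp.zero_apply,
    repr_lie_skew b (b 1) (b 0)] at T0 T1
  have h01 : ⁅b 0, b 1⁆ = 0 := by
    rw [← b.sum_repr ⁅b 0, b 1⁆, Fin.sum_univ_two, show b.repr ⁅b 0, b 1⁆ 1 = 0 by linarith,
      show b.repr ⁅b 0, b 1⁆ 0 = 0 by linarith]
    simp
  have h10 : ⁅b 1, b 0⁆ = 0 := by rw [← lie_skew, h01, neg_zero]
  have hab (x y : g) : ⁅x, y⁆ = 0 := by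
    rw [← b.sum_repr x, ← b.sum_repr y]
    simp only [Fin.sum_univ_two]
    simp [h01, h10]
  obtain ⟨α, hα⟩ := h23.1 b.det fun x y z => by
    have z0 (x : g) : b.det ![0, x] = 0 := b.det.map_coord_zero (m := ![0, x]) 0 rfl
    simp only [hab, z0]; simp
  have h := hα (b 0) (b 1)
  rw [hab, show ![b 0, b 1] = b by ext i; fin_cases i <;> rfl, b.det_self, map_zero] at h
  norm_num at h

lemma not_trivial_dim_three (b : Module.Basis (Fin 3) ℝ g)
    (hU : ∀ x : g, LinearMap.trace ℝ g (LieAlgebra.ad ℝ g x) = 0) (h23 : Is23Trivial g) :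
    False := by
  have hcl : IsClosed3 b.det := by
    rw [isClosed3_iff_d3_eq_zero]
    refine b.ext_alternating fun v hv => ?_
    have := Fintype.card_le_of_injective v hv
    simp at this
  obtain ⟨ω, hω⟩ := h23.2 _ hcl
  have h := hω (b 0) (b 1) (b 2)
  rw [show ![b 0, b 1, b 2] = b by ext i; fin_cases i <;> rfl, b.det_self] at h
  have T0 := hU (b 0)
  have T1 := hU (b 1)
  have T2 := hU (b 2)
  simp only [trace_ad b, Fin.sum_univ_three, lie_self, map_zero, Finsupp.zero_apply,
    repr_lie_skew b (b 1) (b 0), repr_lie_skew b (b 2) (b 0), repr_lie_skew b (b 2) (b 1)]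
    at T0 T1 T2
  rw [← b.sum_repr ⁅b 0, b 1⁆, ← b.sum_repr ⁅b 0, b 2⁆, ← b.sum_repr ⁅b 1, b 2⁆] at h
  simp only [Fin.sum_univ_three, form2_add_left, form2_smul_left, form2_self,
    form2_swap ω (b 1) (b 0), form2_swap ω (b 2) (b 0), form2_swap ω (b 2) (b 1)] at h
  have : (1 : ℝ) = 0 := by
    linear_combination h - ω ![b 1, b 2] * T0 + ω ![b 0, b 2] * T1 - ω ![b 0, b 1] * T2
  norm_num at this

section dim_four
variable (b : Module.Basis (Fin 4) ℝ g)
  (hU : ∀ x : g, LinearMap.trace ℝ g (LieAlgebra.ad ℝ g x) = 0)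

include b hU in
lemma trace_relations :
    b.repr ⁅b 0, b 1⁆ 1 + b.repr ⁅b 0, b 2⁆ 2 + b.repr ⁅b 0, b 3⁆ 3 = 0 ∧
    -b.repr ⁅b 0, b 1⁆ 0 + b.repr ⁅b 1, b 2⁆ 2 + b.repr ⁅b 1, b 3⁆ 3 = 0 ∧
    -b.repr ⁅b 0, b 2⁆ 0 - b.repr ⁅b 1, b 2⁆ 1 + b.repr ⁅b 2, b 3⁆ 3 = 0 ∧
    -b.repr ⁅b 0, b 3⁆ 0 - b.repr ⁅b 1, b 3⁆ 1 - b.repr ⁅b 2, b 3⁆ 2 = 0 := by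
  have T0 := hU (b 0)
  have T1 := hU (b 1)
  have T2 := hU (b 2)
  have T3 := hU (b 3)
  simp only [trace_ad b, Fin.sum_univ_four, lie_self, map_zero, Finsupp.zero_apply,
    repr_lie_skew b (b 1) (b 0), repr_lie_skew b (b 2) (b 0), repr_lie_skew b (b 2) (b 1),
    repr_lie_skew b (b 3) (b 0), repr_lie_skew b (b 3) (b 1), repr_lie_skew b (b 3) (b 2)]
    at T0 T1 T2 T3
  refine ⟨?_, ?_, ?_, ?_⟩ <;> linarith

include b hU in
lemma isClosed3_of_unimodular (c : g [⋀^Fin 3]→ₗ[ℝ] ℝ) : IsClosed3 c := by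
  obtain ⟨T0, T1, T2, T3⟩ := trace_relations b hU
  rw [isClosed3_iff_d3_eq_zero, (d3 c).eq_smul_basis_det b]
  suffices h : d3 c b = 0 by rw [h, zero_smul]
  simp only [d3, AlternatingMap.coe_mk, MultilinearMap.coe_mk]
  rw [← b.sum_repr ⁅b 0, b 1⁆, ← b.sum_repr ⁅b 0, b 2⁆, ← b.sum_repr ⁅b 1, b 2⁆,
    ← b.sum_repr ⁅b 0, b 3⁆, ← b.sum_repr ⁅b 1, b 3⁆, ← b.sum_repr ⁅b 2, b 3⁆]
  simp only [Fin.sum_univ_four, form3_add, form3_smul, form3_self01, form3_self12,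
    form3_swap01 c (b 1) (b 0), form3_swap01 c (b 2) (b 0), form3_swap01 c (b 2) (b 1),
    form3_swap01 c (b 3) (b 0), form3_swap01 c (b 3) (b 1), form3_swap01 c (b 3) (b 2),
    form3_swap12 c _ (b 2) (b 1), form3_swap12 c _ (b 3) (b 1), form3_swap12 c _ (b 3) (b 2)]
  linear_combination -c ![b 1, b 2, b 3] * T0 + c ![b 0, b 2, b 3] * T1
    - c ![b 0, b 1, b 3] * T2 + c ![b 0, b 1, b 2] * T3

/-- The exterior derivative of 2-forms, in coordinates. -/
noncomputable def d2 : (g [⋀^Fin 2]→ₗ[ℝ] ℝ) →ₗ[ℝ] Fin 4 → ℝ :=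
  LinearMap.pi ![d2At (b 1) (b 2) (b 3), d2At (b 0) (b 2) (b 3), d2At (b 0) (b 1) (b 3),
    d2At (b 0) (b 1) (b 2)]

include b hU in
lemma wedge_d2_eq_zero (α : Module.Dual ℝ g) (hα : IsClosed1 α) (ω : g [⋀^Fin 2]→ₗ[ℝ] ℝ) :
    α (b 0) * d2 b ω 0 - α (b 1) * d2 b ω 1 + α (b 2) * d2 b ω 2 - α (b 3) * d2 b ω 3 = 0 := by
  obtain ⟨T0, T1, T2, T3⟩ := trace_relations b hU
  have A (i j) : ∑ k, b.repr ⁅b i, b j⁆ k * α (b k) = 0 := by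
    have h := hα (b i) (b j)
    rw [← b.sum_repr ⁅b i, b j⁆, map_sum] at h
    simpa only [map_smul, smul_eq_mul] using h
  have A01 := A 0 1
  have A02 := A 0 2
  have A03 := A 0 3
  have A12 := A 1 2
  have A13 := A 1 3
  have A23 := A 2 3
  simp only [Fin.sum_univ_four] at A01 A02 A03 A12 A13 A23
  have e0 : d2 b ω 0 = d2At (b 1) (b 2) (b 3) ω := rfl
  have e1 : d2 b ω 1 = d2At (b 0) (b 2) (b 3) ω := rfl
  have e2 : d2 b ω 2 = d2At (b 0) (b 1) (b 3) ω := rfl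
  have e3 : d2 b ω 3 = d2At (b 0) (b 1) (b 2) ω := rfl
  rw [e0, e1, e2, e3]
  simp only [d2At, LinearMap.coe_mk, AddHom.coe_mk]
  rw [← b.sum_repr ⁅b 0, b 1⁆, ← b.sum_repr ⁅b 0, b 2⁆, ← b.sum_repr ⁅b 1, b 2⁆,
    ← b.sum_repr ⁅b 0, b 3⁆, ← b.sum_repr ⁅b 1, b 3⁆, ← b.sum_repr ⁅b 2, b 3⁆]
  simp only [Fin.sum_univ_four, form2_add_left, form2_smul_left, form2_self,
    form2_swap ω (b 1) (b 0), form2_swap ω (b 2) (b 0), form2_swap ω (b 2) (b 1),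
    form2_swap ω (b 3) (b 0), form2_swap ω (b 3) (b 1), form2_swap ω (b 3) (b 2)]
  generalize ω ![b 0, b 1] = w01, ω ![b 0, b 2] = w02, ω ![b 0, b 3] = w03,
    ω ![b 1, b 2] = w12, ω ![b 1, b 3] = w13, ω ![b 2, b 3] = w23
  generalize α (b 0) = a0, α (b 1) = a1, α (b 2) = a2, α (b 3) = a3 at *
  linear_combination
    -((a1 * w23 - a2 * w13 + a3 * w12) * -T0 + (a0 * w23 - a2 * w03 + a3 * w02) * T1
      - (a0 * w13 - a1 * w03 + a3 * w01) * T2 + (a0 * w12 - a1 * w02 + a2 * w01) * T3)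
    - (A01 * w23 - A02 * w13 + A03 * w12 + A12 * w03 - A13 * w02 + A23 * w01)

include b hU in
lemma d2_surjective (h23 : Is23Trivial g) : Function.Surjective (d2 b) := by
  intro u
  obtain ⟨ω, hω⟩ := h23.2 (b.det.curryLeft (u 0 • b 0 - u 1 • b 1 + u 2 • b 2 - u 3 • b 3))
    (isClosed3_of_unimodular b hU _)
  refine ⟨ω, ?_⟩
  have hval (x y z : g) : d2At x y z ω =
      b.det ![u 0 • b 0 - u 1 • b 1 + u 2 • b 2 - u 3 • b 3, x, y, z] := (hω x y z).symm
  ext i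
  fin_cases i <;> refine (hval _ _ _).trans ?_ <;>
    simp [Module.Basis.det_apply, Matrix.det_succ_row_zero, Fin.sum_univ_succ,
      Module.Basis.toMatrix_apply, Fin.succAbove]

include b hU in
lemma not_trivial_dim_four (h23 : Is23Trivial g) : False := by
  have hs := d2_surjective b hU h23
  have : Module.Finite ℝ g := .of_basis b
  have hg : Module.finrank ℝ g = 4 := by simp [Module.finrank_eq_card_basis b]
  have hinj : Function.Injective (d1 (g := g)) := by
    rw [injective_iff_map_eq_zero]
    intro α hα
    have hcl : IsClosed1 α := fun x y => by
      simpa [d1] using congrArg (fun f => f ![x, y]) hα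
    have key (u : Fin 4 → ℝ) :
        α (b 0) * u 0 - α (b 1) * u 1 + α (b 2) * u 2 - α (b 3) * u 3 = 0 := by
      obtain ⟨ω, rfl⟩ := hs u
      exact wedge_d2_eq_zero b hU α hcl ω
    refine b.ext fun i => ?_
    have := key (Pi.single i 1)
    fin_cases i <;> simpa using this
  have hW : Module.finrank ℝ (g [⋀^Fin 2]→ₗ[ℝ] ℝ) = 6 := by
    rw [(exteriorPower.alternatingMapLinearEquiv (R := ℝ) (n := 2) (M := g) (N := ℝ)).finrank_eq]
    rw [Module.finrank_linearMap_self, exteriorPower.finrank_eq, hg]; rfl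
  have : Module.Finite ℝ (g [⋀^Fin 2]→ₗ[ℝ] ℝ) := Module.finite_of_finrank_eq_succ hW
  have hle : LinearMap.range (d1 (g := g)) ≤ LinearMap.ker (d2 b) := by
    rintro _ ⟨α, rfl⟩
    ext i
    fin_cases i <;> exact d2At_d1 _ _ _ α
  have h1 := Submodule.finrank_mono hle
  have h2 := (d2 b).finrank_range_add_finrank_ker
  rw [LinearMap.finrank_range_of_inj hinj, Subspace.dual_finrank_eq, hg] at h1
  rw [LinearMap.range_eq_top.2 hs, finrank_top, hW, Module.finrank_fin_fun] at h2
  omega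

end dim_four

end CE

/-- every `(2,3)`-trivial real Lie algebra of dimension two, three or
four is not unimodular. -/
theorem stmt_12 (g : Type) [LieRing g] [LieAlgebra ℝ g] [FiniteDimensional ℝ g]
    (hdim : Module.finrank ℝ g = 2 ∨ Module.finrank ℝ g = 3 ∨ Module.finrank ℝ g = 4)
    (h23 : CE.Is23Trivial g) :
    ∃ x : g, LinearMap.trace ℝ g (LieAlgebra.ad ℝ g x) ≠ 0 := by
  by_contra! hU
  rcases hdim with h | h | h
  · exact CE.not_trivial_dim_two (Module.finBasisOfFinrankEq ℝ g h) hU h23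
  · exact CE.not_trivial_dim_three (Module.finBasisOfFinrankEq ℝ g h) hU h23
  · exact CE.not_trivial_dim_four (Module.finBasisOfFinrankEq ℝ g h) hU h23
end
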